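/- Let q = 2 and for each n let X̃^{(n)} be uniformly distributed on D̃_{2,1}^n = n^{1/2} B_{2,1}^n. Then (√n / √(log n)) · (‖X̃^{(n)}‖_∞ - μ_{2,n}) converges in distribution, as n → ∞, to a centered Gaussian random variable with variance 1/4, where μ_{2,n} := (1/n) Σ_{j=1}^n n^{1/2}/κ_2(j) and κ_2(j) = Σ_{i=1}^j i^{-1/2}. -/

import Mathlib

open MeasureTheory Finset Filter
open scoped ENNReal NNReal

noncomputable section

/-- `sortedAbs x i` is the `i`-th largest value among `|x 0|, …, |x (n-1)|`
(`i = 0` gives the largest), i.e. the non-increasing rearrangement of `|x|`. -/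
def sortedAbs {n : ℕ} (x : Fin n → ℝ) (i : Fin n) : ℝ :=
  |x (Tuple.sort (fun j => |x j|) i.rev)|

/-- The Lorentz norm `‖x‖_{2,1} = ∑_{i=1}^n i^{-1/2} x_i^*`. -/
def lorentzNorm2 {n : ℕ} (x : Fin n → ℝ) : ℝ :=
  ∑ i : Fin n, ((i : ℝ) + 1) ^ (-(1 / 2) : ℝ) * sortedAbs x i

/-- The unit ball of the Lorentz space `ℓ_{2,1}^n`. -/
def lorentzBall2 (n : ℕ) : Set (Fin n → ℝ) :=
  {x | lorentzNorm2 x ≤ 1}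

/-- The normalized Lorentz ball `D̃_{2,1}^n = n^{1/2} B_{2,1}^n`. -/
def scaledLorentzBall2 (n : ℕ) : Set (Fin n → ℝ) :=
  (fun x => ((n : ℝ) ^ ((1 : ℝ) / 2)) • x) '' lorentzBall2 n

/-- The uniform probability measure on a set (normalized restricted Lebesgue measure). -/
def unifOn {n : ℕ} (s : Set (Fin n → ℝ)) : Measure (Fin n → ℝ) :=
  (volume s)⁻¹ • volume.restrict s

/-- `κ_2(j) = ∑_{i=1}^j i^{-1/2}`. -/
def kappa2 (j : ℕ) : ℝ := ∑ i ∈ Finset.range j, ((i : ℝ) + 1) ^ (-(1 / 2) : ℝ)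

/-- The centering `μ_{2,n} = (1/n) ∑_{j=1}^n n^{1/2}/κ_2(j)`. -/
def mu2n (n : ℕ) : ℝ :=
  (1 / (n : ℝ)) * ∑ j ∈ Finset.range n, (n : ℝ) ^ ((1 : ℝ) / 2) / kappa2 (j + 1)

/-- The Lorentz functional with weights `w`, as a maximum over rearrangements. -/
def permSup {n : ℕ} (w : ℕ → ℝ) (x : Fin n → ℝ) : ℝ :=
  univ.sup' univ_nonempty fun σ : Equiv.Perm (Fin n) => ∑ i : Fin n, w i * |x (σ i)|

lemma sum_comp_perm_le_of_antitone {n : ℕ} {w : ℕ → ℝ} (hw : Antitone w) {y : Fin n → ℝ}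
    (hy : Antitone y) (σ : Equiv.Perm (Fin n)) :
    ∑ i : Fin n, w i * y (σ i) ≤ ∑ i : Fin n, w i * y i := by
  have h : Monovary (fun i : Fin n => w i) y := fun i j hij =>
    hw (Fin.val_fin_le.2 (le_of_not_gt fun h => (hy h.le).not_gt hij))
  exact h.sum_mul_comp_perm_le_sum_mul

lemma sum_sortedAbs_eq_permSup {n : ℕ} {w : ℕ → ℝ} (hw : Antitone w) (x : Fin n → ℝ) :
    ∑ i : Fin n, w i * sortedAbs x i = permSup w x := by
  set τ : Equiv.Perm (Fin n) := Fin.revPerm.trans (Tuple.sort fun j => |x j|) with hτ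
  have hs : ∀ i, sortedAbs x i = |x (τ i)| := fun i => rfl
  have hanti : Antitone (fun i => |x (τ i)|) := fun i j hij =>
    Tuple.monotone_sort (fun j => |x j|) (Fin.rev_le_rev.2 hij)
  apply le_antisymm
  · exact le_sup' (fun σ : Equiv.Perm (Fin n) => ∑ i : Fin n, w i * |x (σ i)|) (mem_univ τ)
  · refine sup'_le _ _ fun σ _ => ?_
    have := sum_comp_perm_le_of_antitone hw hanti (σ.trans τ.symm)
    simpa [hs] using this

lemma lorentzNorm2_eq_permSup {n : ℕ} (x : Fin n → ℝ) :
    lorentzNorm2 x = permSup (fun i => ((i : ℝ) + 1) ^ (-(1 / 2) : ℝ)) x := by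
  refine sum_sortedAbs_eq_permSup (w := fun i : ℕ => ((i : ℝ) + 1) ^ (-(1 / 2) : ℝ))
    (fun i j hij => ?_) x
  exact Real.rpow_le_rpow_of_nonpos (by positivity) (by gcongr) (by norm_num)

lemma permSup_smul {n : ℕ} (w : ℕ → ℝ) {c : ℝ} (hc : 0 ≤ c) (x : Fin n → ℝ) :
    permSup w (c • x) = c * permSup w x := by
  rw [permSup, permSup, mul₀_sup' hc]
  refine sup'_congr _ rfl fun σ _ => ?_
  simp only [Pi.smul_apply, smul_eq_mul, abs_mul, abs_of_nonneg hc, mul_sum]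
  exact sum_congr rfl fun i _ => by ring

lemma permSup_smul_weight {n : ℕ} (w : ℕ → ℝ) {c : ℝ} (hc : 0 ≤ c) (x : Fin n → ℝ) :
    permSup (fun i => c * w i) x = c * permSup w x := by
  rw [permSup, permSup, mul₀_sup' hc]
  refine sup'_congr _ rfl fun σ _ => ?_
  simp only [mul_sum]
  exact sum_congr rfl fun i _ => by ring

lemma permSup_nonneg {n : ℕ} {w : ℕ → ℝ} (hw : ∀ i, 0 ≤ w i) (x : Fin n → ℝ) :
    0 ≤ permSup w x :=
  le_trans (sum_nonneg fun (i : Fin n) _ => mul_nonneg (hw i) (abs_nonneg (x i)))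
    (le_sup' (fun σ : Equiv.Perm (Fin n) => ∑ i : Fin n, w i * |x (σ i)|)
      (mem_univ (Equiv.refl (Fin n))))

@[fun_prop]
lemma measurable_permSup {n : ℕ} (w : ℕ → ℝ) :
    Measurable (permSup w : (Fin n → ℝ) → ℝ) := by
  have : Continuous (permSup w : (Fin n → ℝ) → ℝ) :=
    Continuous.finset_sup'_apply _ fun σ _ => by fun_prop
  exact this.measurable

/-- The signed coordinate permutation `x ↦ (ε i * x (σ i))_i`. -/
def signedPerm {n : ℕ} (ε : Fin n → ℤˣ) (σ : Equiv.Perm (Fin n)) :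
    (Fin n → ℝ) →ₗ[ℝ] (Fin n → ℝ) where
  toFun x i := ((ε i : ℤ) : ℝ) * x (σ i)
  map_add' x y := by ext i; simp [mul_add]
  map_smul' c x := by ext i; simp; ring

lemma signedPerm_apply {n : ℕ} (ε : Fin n → ℤˣ) (σ : Equiv.Perm (Fin n)) (x : Fin n → ℝ)
    (i : Fin n) : signedPerm ε σ x i = ((ε i : ℤ) : ℝ) * x (σ i) := rfl

lemma abs_signedPerm_apply {n : ℕ} (ε : Fin n → ℤˣ) (σ : Equiv.Perm (Fin n)) (x : Fin n → ℝ)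
    (i : Fin n) : |signedPerm ε σ x i| = |x (σ i)| := by
  rcases Int.units_eq_one_or (ε i) with h | h <;> simp [signedPerm_apply, h]

lemma signedPerm_injective {n : ℕ} (ε : Fin n → ℤˣ) (σ : Equiv.Perm (Fin n)) :
    Function.Injective (signedPerm ε σ) := by
  rw [injective_iff_map_eq_zero]
  intro x hx
  ext i
  have := abs_signedPerm_apply ε σ x (σ.symm i)
  simpa [hx] using this.symm

lemma permSup_signedPerm {n : ℕ} (w : ℕ → ℝ) (ε : Fin n → ℤˣ) (σ : Equiv.Perm (Fin n))
    (x : Fin n → ℝ) : permSup w (signedPerm ε σ x) = permSup w x := by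
  simp only [permSup, abs_signedPerm_apply]
  apply le_antisymm
  · refine sup'_le _ _ fun τ _ => ?_
    exact le_sup' (fun σ : Equiv.Perm (Fin n) => ∑ i : Fin n, w i * |x (σ i)|)
      (mem_univ (τ.trans σ))
  · refine sup'_le _ _ fun τ _ => ?_
    have := le_sup' (fun τ : Equiv.Perm (Fin n) => ∑ i : Fin n, w i * |x (σ (τ i))|)
      (mem_univ (τ.trans σ.symm))
    simpa only [Equiv.trans_apply, Equiv.apply_symm_apply] using this

lemma norm_signedPerm {n : ℕ} (ε : Fin n → ℤˣ) (σ : Equiv.Perm (Fin n))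
    (x : Fin n → ℝ) : ‖signedPerm ε σ x‖ = ‖x‖ := by
  apply le_antisymm
  · refine (pi_norm_le_iff_of_nonneg (norm_nonneg _)).2 fun i => ?_
    rw [Real.norm_eq_abs, abs_signedPerm_apply]
    exact norm_le_pi_norm x (σ i)
  · refine (pi_norm_le_iff_of_nonneg (norm_nonneg _)).2 fun i => ?_
    have := norm_le_pi_norm (signedPerm ε σ x) (σ.symm i)
    rw [Real.norm_eq_abs, abs_signedPerm_apply] at this
    simpa using this

/-- The open Weyl chamber `x 0 > x 1 > ⋯ > x (n-1) > 0`. -/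
def chamber (n : ℕ) : Set (Fin n → ℝ) := {x | StrictAnti x ∧ ∀ i, 0 < x i}

lemma strictAnti_comp_perm_unique {n : ℕ} {y : Fin n → ℝ} {σ τ : Equiv.Perm (Fin n)}
    (hσ : StrictAnti (y ∘ σ)) (hτ : StrictAnti (y ∘ τ)) : σ = τ := by
  have hmono : StrictMono (τ.symm ∘ σ) := by
    intro i j hij
    have := hσ hij
    rw [← hτ.lt_iff_gt]
    simpa using this
  have h : τ.symm ∘ σ = id := (hmono.range_inj strictMono_id).1 <| by
    rw [Set.range_id, (τ.symm.surjective.comp σ.surjective).range_eq]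
  ext i
  have := congrFun h i
  simp only [Function.comp_apply, id_eq, Equiv.symm_apply_eq] at this
  rw [this]

lemma existsUnique_signedPerm_mem_chamber {n : ℕ} {x : Fin n → ℝ} (h0 : ∀ i, x i ≠ 0)
    (hinj : Function.Injective fun i => |x i|) :
    ∃! g : (Fin n → ℤˣ) × Equiv.Perm (Fin n), signedPerm g.1 g.2 x ∈ chamber n := by
  set τ : Equiv.Perm (Fin n) := Fin.revPerm.trans (Tuple.sort fun j => |x j|) with hτ
  have hanti : Antitone (fun i => |x (τ i)|) := fun i j hij =>
    Tuple.monotone_sort (fun j => |x j|) (Fin.rev_le_rev.2 hij)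
  have hsa : StrictAnti (fun i => |x (τ i)|) :=
    hanti.strictAnti_of_injective (hinj.comp τ.injective)
  have key : ∀ i, (((if 0 < x (τ i) then (1 : ℤˣ) else -1 : ℤˣ) : ℤ) : ℝ) * x (τ i)
      = |x (τ i)| := by
    intro i
    split_ifs with h
    · simp [abs_of_pos h]
    · simp [abs_of_nonpos (not_lt.1 h)]
  refine ⟨(fun i => if 0 < x (τ i) then 1 else -1, τ), ⟨?_, ?_⟩, ?_⟩
  · intro i j hij
    simp only [signedPerm_apply, key]
    exact hsa hij
  · intro i
    simp only [signedPerm_apply, key]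
    exact abs_pos.2 (h0 _)
  · rintro ⟨ε, σ⟩ ⟨h1, h2⟩
    have habs : ∀ i, signedPerm ε σ x i = |x (σ i)| := fun i => by
      rw [← abs_signedPerm_apply ε σ x i, abs_of_pos (h2 i)]
    have hσ : StrictAnti ((fun i => |x i|) ∘ σ) := by
      intro i j hij
      have := h1 hij
      simp only [habs] at this
      exact this
    obtain rfl := strictAnti_comp_perm_unique hσ hsa
    refine Prod.ext (funext fun i => ?_) rfl
    have := h2 i
    simp only [signedPerm_apply] at this
    rcases Int.units_eq_one_or (ε i) with h | h
    · simp only [h, Units.val_one, Int.cast_one, one_mul] at this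
      simp [h, this]
    · simp only [h, Units.val_neg, Units.val_one, Int.cast_neg, Int.cast_one, neg_mul,
        one_mul] at this
      simp [h, not_lt.2 (neg_pos.1 this).le]

lemma exists_lintegral_comp_linearMap {n : ℕ} {f : (Fin n → ℝ) →ₗ[ℝ] (Fin n → ℝ)}
    (hf : Function.Injective f) :
    ∃ c : ℝ≥0∞, ∀ G : (Fin n → ℝ) → ℝ≥0∞, Measurable G →
      ∫⁻ x, G (f x) = c * ∫⁻ x, G x := by
  have hdet : LinearMap.det f ≠ 0 := by
    have := (LinearEquiv.ofInjectiveEndo f hf).isUnit_det'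
    exact this.ne_zero
  refine ⟨ENNReal.ofReal |(LinearMap.det f)⁻¹|, fun G hG => ?_⟩
  have hfm : Measurable f := (LinearMap.continuous_of_finiteDimensional f).measurable
  rw [← lintegral_map hG hfm, Measure.map_linearMap_addHaar_eq_smul_addHaar _ hdet,
    lintegral_smul_measure, smul_eq_mul]

lemma ae_linearMap_ne_zero {n : ℕ} {f : (Fin n → ℝ) →ₗ[ℝ] ℝ} (hf : f ≠ 0) :
    ∀ᵐ x : Fin n → ℝ, f x ≠ 0 := by
  have : volume ((LinearMap.ker f : Submodule ℝ (Fin n → ℝ)) : Set (Fin n → ℝ)) = 0 :=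
    Measure.addHaar_submodule _ _ fun h => hf (LinearMap.ker_eq_top.1 h)
  rw [ae_iff]
  convert this using 2
  ext x
  simp

lemma ae_forall_coord_ne_zero (n : ℕ) : ∀ᵐ x : Fin n → ℝ, ∀ i, x i ≠ 0 := by
  rw [ae_all_iff]
  intro i
  refine ae_linearMap_ne_zero (f := LinearMap.proj i) fun h => ?_
  simpa using LinearMap.congr_fun h (fun _ => 1)

lemma ae_abs_injective (n : ℕ) :
    ∀ᵐ x : Fin n → ℝ, Function.Injective fun i => |x i| := by
  have h : ∀ᵐ x : Fin n → ℝ, ∀ i j, i ≠ j → x i - x j ≠ 0 ∧ x i + x j ≠ 0 := by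
    rw [ae_all_iff]
    intro i
    rw [ae_all_iff]
    intro j
    by_cases hij : i = j
    · simp [hij]
    let p (k : Fin n) : (Fin n → ℝ) →ₗ[ℝ] ℝ := LinearMap.proj k
    have h1 := ae_linearMap_ne_zero
      (f := (p i - p j)) fun h => by
        simpa [p, Ne.symm hij] using LinearMap.congr_fun h (Pi.single i 1)
    have h2 := ae_linearMap_ne_zero
      (f := (p i + p j)) fun h => by
        simpa [p, Ne.symm hij] using LinearMap.congr_fun h (Pi.single i 1)
    filter_upwards [h1, h2] with x h1 h2 _
    exact ⟨by simpa [p] using h1, by simpa [p] using h2⟩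
  filter_upwards [h] with x hx i j hij
  by_contra hne
  rcases abs_eq_abs.1 hij with h | h
  · exact (hx i j hne).1 (by rw [h, sub_self])
  · exact (hx i j hne).2 (by rw [h, neg_add_cancel])

lemma measurableSet_chamber (n : ℕ) : MeasurableSet (chamber n) := by
  have : chamber n = (⋂ i : Fin n, ⋂ j : Fin n, {x | i < j → x j < x i}) ∩ ⋂ i, {x | 0 < x i} := by
    ext x
    simp [chamber, StrictAnti]
  rw [this]
  refine .inter (.iInter fun i => .iInter fun j => ?_) (.iInter fun i => ?_)
  · by_cases h : i < j
    · simpa [h] using measurableSet_lt (measurable_pi_apply j) (measurable_pi_apply i)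
    · simp [h]
  · exact measurableSet_lt measurable_const (measurable_pi_apply i)

lemma exists_lintegral_eq_mul_lintegral_chamber (n : ℕ) :
    ∃ c : ℝ≥0∞, ∀ H : (Fin n → ℝ) → ℝ≥0∞, Measurable H →
      (∀ ε σ x, H (signedPerm ε σ x) = H x) →
      ∫⁻ x, H x = c * ∫⁻ x, (chamber n).indicator H x := by
  choose c hc using fun g : (Fin n → ℤˣ) × Equiv.Perm (Fin n) =>
    exists_lintegral_comp_linearMap (signedPerm_injective g.1 g.2)
  refine ⟨∑ g, c g, fun H hH hinv => ?_⟩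
  have hmeas : Measurable ((chamber n).indicator H) := hH.indicator (measurableSet_chamber n)
  calc ∫⁻ x, H x = ∫⁻ x, ∑ g : (Fin n → ℤˣ) × Equiv.Perm (Fin n),
        (chamber n).indicator H (signedPerm g.1 g.2 x) := by
        refine lintegral_congr_ae ?_
        filter_upwards [ae_forall_coord_ne_zero n, ae_abs_injective n] with x h0 hinj
        obtain ⟨g, hg, huniq⟩ := existsUnique_signedPerm_mem_chamber h0 hinj
        rw [Finset.sum_eq_single g]
        · rw [Set.indicator_of_mem hg, hinv]
        · intro g' _ hne
          exact Set.indicator_of_notMem (fun h => hne (huniq g' h)) _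
        · simp
    _ = ∑ g : (Fin n → ℤˣ) × Equiv.Perm (Fin n),
        ∫⁻ x, (chamber n).indicator H (signedPerm g.1 g.2 x) :=
        lintegral_finsetSum _ fun g _ => hmeas.comp
          (LinearMap.continuous_of_finiteDimensional _).measurable
    _ = (∑ g, c g) * ∫⁻ x, (chamber n).indicator H x := by
        rw [Finset.sum_mul]
        exact Finset.sum_congr rfl fun g _ => hc g _ hmeas

/-- Extension of a finite sequence by zero. -/
def zeroExt {n : ℕ} (x : Fin n → ℝ) (k : ℕ) : ℝ := if h : k < n then x ⟨k, h⟩ else 0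

lemma zeroExt_val {n : ℕ} (x : Fin n → ℝ) (i : Fin n) : zeroExt x i = x i := by
  simp [zeroExt]

lemma zeroExt_of_le {n : ℕ} (x : Fin n → ℝ) {k : ℕ} (h : n ≤ k) : zeroExt x k = 0 := by
  simp [zeroExt, not_lt.2 h]

/-- The partial sums of a weight sequence. -/
def partialSum (w : ℕ → ℝ) (k : ℕ) : ℝ := ∑ i ∈ range k, w i

lemma partialSum_succ_pos {w : ℕ → ℝ} (hw : ∀ i, 0 < w i) (k : ℕ) : 0 < partialSum w (k + 1) :=
  sum_pos (fun i _ => hw i) (by simp)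

/-- The weighted gaps `K_{j+1} (x_j - x_{j+1})` of a vector. -/
def weightedGap (w : ℕ → ℝ) (n : ℕ) : (Fin n → ℝ) →ₗ[ℝ] (Fin n → ℝ) where
  toFun x j := partialSum w (j + 1) * (zeroExt x j - zeroExt x (j + 1))
  map_add' x y := by
    ext j
    simp only [zeroExt, Pi.add_apply]
    split_ifs <;> ring
  map_smul' c x := by
    ext j
    simp only [zeroExt, Pi.smul_apply, smul_eq_mul, RingHom.id_apply]
    split_ifs <;> ring

lemma weightedGap_apply (w : ℕ → ℝ) {n : ℕ} (x : Fin n → ℝ) (j : Fin n) :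
    weightedGap w n x j = partialSum w (j + 1) * (zeroExt x j - zeroExt x (j + 1)) := rfl

lemma zeroExt_eq_sum_weightedGap {w : ℕ → ℝ} (hw : ∀ i, 0 < w i) {n : ℕ} (hn : 0 < n)
    (x : Fin n → ℝ) :
    x ⟨0, hn⟩ = ∑ j : Fin n, weightedGap w n x j / partialSum w (j + 1) := by
  have h : ∀ j : Fin n, weightedGap w n x j / partialSum w (j + 1)
      = zeroExt x j - zeroExt x (j + 1) := fun j => by
    rw [weightedGap_apply, mul_div_cancel_left₀ _ (partialSum_succ_pos hw j).ne']
  rw [sum_congr rfl fun j _ => h j,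
    Fin.sum_univ_eq_sum_range (fun j => zeroExt x j - zeroExt x (j + 1)) n, sum_range_sub',
    zeroExt_of_le x le_rfl, sub_zero]
  exact (zeroExt_val x ⟨0, hn⟩).symm

lemma sum_mul_eq_sum_partialSum_mul (w e : ℕ → ℝ) (n : ℕ) :
    ∑ i ∈ range n, w i * e i
      = ∑ j ∈ range n, partialSum w (j + 1) * (e j - e (j + 1)) + partialSum w n * e n := by
  induction n with
  | zero => simp [partialSum]
  | succ n ih =>
    rw [sum_range_succ, sum_range_succ, ih]
    simp only [partialSum, sum_range_succ]
    ring

lemma sum_weightedGap (w : ℕ → ℝ) {n : ℕ} (x : Fin n → ℝ) :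
    ∑ j, weightedGap w n x j = ∑ i : Fin n, w i * x i := by
  have h1 := Fin.sum_univ_eq_sum_range (fun i => w i * zeroExt x i) n
  have h2 := Fin.sum_univ_eq_sum_range
    (fun j => partialSum w (j + 1) * (zeroExt x j - zeroExt x (j + 1))) n
  have h3 := sum_mul_eq_sum_partialSum_mul w (zeroExt x) n
  rw [zeroExt_of_le x le_rfl, mul_zero, add_zero, ← h1, ← h2] at h3
  simp only [zeroExt_val] at h3 h2
  rw [h3]
  simp [weightedGap_apply, zeroExt_val]

lemma weightedGap_injective {w : ℕ → ℝ} (hw : ∀ i, 0 < w i) (n : ℕ) :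
    Function.Injective (weightedGap w n) := by
  rw [injective_iff_map_eq_zero]
  intro x hx
  have hstep : ∀ j, j < n → zeroExt x j = zeroExt x (j + 1) := fun j hj => by
    have := congrFun hx ⟨j, hj⟩
    simp only [weightedGap_apply, Pi.zero_apply, mul_eq_zero,
      (partialSum_succ_pos hw j).ne', false_or] at this
    linarith
  have hall : ∀ j, j ≤ n → zeroExt x j = 0 := fun j hj => by
    induction hj using Nat.decreasingInduction with
    | self => exact zeroExt_of_le x le_rfl
    | of_succ k hk ih => rw [hstep k hk, ih]
  ext i
  rw [← zeroExt_val x i, hall i i.2.le, Pi.zero_apply]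

lemma mem_chamber_iff_weightedGap_pos {w : ℕ → ℝ} (hw : ∀ i, 0 < w i) {n : ℕ} (x : Fin n → ℝ) :
    x ∈ chamber n ↔ ∀ j, 0 < weightedGap w n x j := by
  simp only [weightedGap_apply, mul_pos_iff_of_pos_left (partialSum_succ_pos hw _), sub_pos]
  constructor
  · rintro ⟨h1, h2⟩ j
    rw [zeroExt_val]
    by_cases h : (j : ℕ) + 1 < n
    · rw [zeroExt, dif_pos h]
      exact h1 (Fin.lt_def.2 (Nat.lt_succ_self _))
    · rw [zeroExt_of_le x (not_lt.1 h)]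
      exact h2 j
  · intro h
    have hlt : ∀ k, ∀ j, j < k → j < n → k ≤ n → zeroExt x k < zeroExt x j := by
      intro k
      induction k with
      | zero => intro j hj; omega
      | succ k ih =>
        intro j hj hjn hk
        have hstep := h ⟨k, hk⟩
        rcases Nat.lt_succ_iff_lt_or_eq.1 hj with h' | rfl
        · exact hstep.trans (ih j h' hjn (by omega))
        · exact hstep
    refine ⟨fun i j hij => ?_, fun i => ?_⟩
    · simpa only [zeroExt_val] using hlt j i hij i.2 j.2.le
    · simpa only [zeroExt_val, zeroExt_of_le x le_rfl] using hlt n i i.2 i.2 le_rfl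

lemma norm_eq_of_mem_chamber {n : ℕ} (hn : 0 < n) {x : Fin n → ℝ} (hx : x ∈ chamber n) :
    ‖x‖ = x ⟨0, hn⟩ := by
  apply le_antisymm
  · refine (pi_norm_le_iff_of_nonneg (hx.2 _).le).2 fun i => ?_
    rw [Real.norm_eq_abs, abs_of_pos (hx.2 i)]
    exact hx.1.antitone (Fin.le_def.2 (Nat.zero_le _))
  · exact (le_abs_self _).trans (norm_le_pi_norm x _)

lemma permSup_eq_of_mem_chamber {n : ℕ} {w : ℕ → ℝ} (hw : Antitone w) {x : Fin n → ℝ}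
    (hx : x ∈ chamber n) : permSup w x = ∑ i : Fin n, w i * x i := by
  have habs : ∀ i, |x i| = x i := fun i => abs_of_pos (hx.2 i)
  simp only [permSup, habs]
  apply le_antisymm
  · exact sup'_le _ _ fun σ _ => sum_comp_perm_le_of_antitone hw hx.1.antitone σ
  · exact le_sup' (fun σ : Equiv.Perm (Fin n) => ∑ i : Fin n, w i * x (σ i))
      (mem_univ (Equiv.refl _))

instance isProbabilityMeasure_expMeasure_one : IsProbabilityMeasure (ProbabilityTheory.expMeasure 1) :=
  ProbabilityTheory.isProbabilityMeasure_expMeasure one_pos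

lemma pi_withDensity_ofReal {ι : Type*} [Fintype ι] {d : ℝ → ℝ} (hd : ∀ x, 0 ≤ d x)
    (hint : Integrable d) [SigmaFinite (volume.withDensity fun x => ENNReal.ofReal (d x))] :
    Measure.pi (fun _ : ι => volume.withDensity fun x => ENNReal.ofReal (d x))
      = volume.withDensity fun z : ι → ℝ => ENNReal.ofReal (∏ i, d (z i)) := by
  refine Measure.pi_eq fun s hs => ?_
  rw [withDensity_apply _ (MeasurableSet.univ_pi hs), volume_pi, Measure.restrict_pi_pi,
    ← ofReal_integral_eq_lintegral_ofReal, integral_fintype_prod_eq_prod (fun _ => d),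
    ENNReal.ofReal_prod_of_nonneg fun i _ => integral_nonneg fun x => hd x]
  · refine prod_congr rfl fun i _ => ?_
    rw [withDensity_apply _ (hs i), ofReal_integral_eq_lintegral_ofReal hint.restrict
      (ae_of_all _ hd)]
  · exact Integrable.fintype_prod fun i => hint.restrict
  · exact ae_of_all _ fun z => prod_nonneg fun i _ => hd _

lemma lintegral_pi_expMeasure_one {n : ℕ} {G : (Fin n → ℝ) → ℝ≥0∞} (hG : Measurable G) :
    ∫⁻ z, G z ∂(Measure.pi fun _ : Fin n => ProbabilityTheory.expMeasure 1)
      = ∫⁻ z, {z : Fin n → ℝ | ∀ i, 0 < z i}.indicator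
          (fun z => ENNReal.ofReal (Real.exp (-∑ i, z i)) * G z) z := by
  have hlaw : ProbabilityTheory.expMeasure 1
      = volume.withDensity fun x =>
        ENNReal.ofReal (ProbabilityTheory.exponentialPDFReal 1 x) := rfl
  have hnn := ProbabilityTheory.exponentialPDFReal_nonneg one_pos
  have hint : Integrable (ProbabilityTheory.exponentialPDFReal 1) := by
    refine ⟨(ProbabilityTheory.measurable_exponentialPDFReal 1).aestronglyMeasurable, ?_⟩
    rw [hasFiniteIntegral_iff_ofReal (ae_of_all _ hnn)]
    exact (ProbabilityTheory.lintegral_exponentialPDF_eq_one one_pos).trans_lt ENNReal.one_lt_top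
  have : SigmaFinite (volume.withDensity fun x =>
      ENNReal.ofReal (ProbabilityTheory.exponentialPDFReal 1 x)) := by
    rw [← hlaw]; infer_instance
  have hdm : Measurable fun z : Fin n → ℝ =>
      ENNReal.ofReal (∏ i, ProbabilityTheory.exponentialPDFReal 1 (z i)) :=
    (Finset.measurable_prod _ fun i _ => (ProbabilityTheory.measurable_exponentialPDFReal 1).comp
      (measurable_pi_apply i)).ennreal_ofReal
  rw [hlaw, pi_withDensity_ofReal hnn hint, lintegral_withDensity_eq_lintegral_mul _ hdm hG]
  refine lintegral_congr_ae ?_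
  filter_upwards [ae_forall_coord_ne_zero n] with z hz
  by_cases hpos : ∀ i, 0 < z i
  · rw [Set.indicator_of_mem (by exact hpos), Pi.mul_apply, ← sum_neg_distrib, Real.exp_sum]
    congr 2
    refine prod_congr rfl fun i _ => ?_
    simp [ProbabilityTheory.exponentialPDFReal, ProbabilityTheory.gammaPDFReal, (hpos i).le]
  · rw [Set.indicator_of_notMem (by exact hpos), Pi.mul_apply]
    obtain ⟨i, hi⟩ := not_forall.1 hpos
    have hlt : z i < 0 := lt_of_le_of_ne (not_lt.1 hi) (hz i)
    rw [prod_eq_zero (mem_univ i), ENNReal.ofReal_zero, zero_mul]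
    simp [ProbabilityTheory.exponentialPDFReal, ProbabilityTheory.gammaPDFReal, not_le.2 hlt]

/-- The weighted sum `∑ z_j / K_{j+1}`. -/
def gapSum (w : ℕ → ℝ) {n : ℕ} (z : Fin n → ℝ) : ℝ :=
  ∑ j : Fin n, z j / partialSum w (j + 1)

@[fun_prop]
lemma measurable_gapSum (w : ℕ → ℝ) {n : ℕ} : Measurable (gapSum w : (Fin n → ℝ) → ℝ) := by
  unfold gapSum
  fun_prop

lemma exists_lintegral_norm_mul_exp_permSup {n : ℕ} (hn : 0 < n) {w : ℕ → ℝ} (hw : Antitone w)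
    (hpos : ∀ i, 0 < w i) :
    ∃ C : ℝ≥0∞, ∀ F : ℝ → ℝ≥0∞, Measurable F →
      ∫⁻ x : Fin n → ℝ, ENNReal.ofReal (Real.exp (-permSup w x)) * F ‖x‖
        = C * ∫⁻ z, F (gapSum w z) ∂(Measure.pi fun _ : Fin n => ProbabilityTheory.expMeasure 1) := by
  obtain ⟨c₁, h₁⟩ := exists_lintegral_eq_mul_lintegral_chamber n
  obtain ⟨c₂, h₂⟩ := exists_lintegral_comp_linearMap (weightedGap_injective hpos n)
  refine ⟨c₁ * c₂, fun F hF => ?_⟩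
  have hmeasG : Measurable ({z : Fin n → ℝ | ∀ i, 0 < z i}.indicator
      fun z => ENNReal.ofReal (Real.exp (-∑ i, z i)) * F (gapSum w z)) := by
    refine Measurable.indicator ?_ ?_
    · exact .mul (by fun_prop) (hF.comp (measurable_gapSum w))
    · simp only [Set.ofPred_forall]
      exact .iInter fun i => measurableSet_lt measurable_const (measurable_pi_apply i)
  rw [lintegral_pi_expMeasure_one (G := fun z => F (gapSum w z)) (by fun_prop), mul_assoc, ← h₂ _ hmeasG, h₁]
  · congr 1
    refine lintegral_congr fun x => ?_
    by_cases hx : x ∈ chamber n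
    · rw [Set.indicator_of_mem hx,
        Set.indicator_of_mem (by exact (mem_chamber_iff_weightedGap_pos hpos x).1 hx),
        sum_weightedGap, permSup_eq_of_mem_chamber hw hx, norm_eq_of_mem_chamber hn hx,
        zeroExt_eq_sum_weightedGap hpos hn x, gapSum]
    · have hx' : weightedGap w n x ∉ {z : Fin n → ℝ | ∀ i, 0 < z i} := fun h =>
        hx ((mem_chamber_iff_weightedGap_pos hpos x).2 h)
      rw [Set.indicator_of_notMem hx, Set.indicator_of_notMem hx']
  · exact .mul ((measurable_permSup w).neg.exp.ennreal_ofReal) (hF.comp measurable_norm)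
  · intro ε σ x
    rw [permSup_signedPerm, norm_signedPerm]

lemma lintegral_gammaMeasure_natCast_add_one (n : ℕ) {g : ℝ → ℝ≥0∞} (hg : Measurable g) :
    ∫⁻ r, g r ∂(ProbabilityTheory.gammaMeasure (n + 1) 1)
      = ENNReal.ofReal (1 / Real.Gamma (n + 1)) *
        ∫⁻ r in Set.Ioi 0, ENNReal.ofReal (r ^ n * Real.exp (-r)) * g r := by
  have hm : Measurable (ProbabilityTheory.gammaPDF (n + 1) 1) :=
    (ProbabilityTheory.measurable_gammaPDFReal _ _).ennreal_ofReal
  rw [ProbabilityTheory.gammaMeasure, lintegral_withDensity_eq_lintegral_mul _ hm hg,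
    ← lintegral_const_mul _ (by fun_prop), ← lintegral_indicator measurableSet_Ioi]
  refine lintegral_congr_ae ?_
  filter_upwards [Measure.ae_ne volume (0 : ℝ)] with r hr
  rcases lt_or_gt_of_ne hr with h | h
  · simp [ProbabilityTheory.gammaPDF, ProbabilityTheory.gammaPDFReal, not_le.2 h, not_lt.2 h.le]
  · have hG : 0 ≤ 1 / Real.Gamma (n + 1) := by positivity
    rw [Set.indicator_of_mem (by exact h), ← mul_assoc, ← ENNReal.ofReal_mul hG, Pi.mul_apply,
      ProbabilityTheory.gammaPDF, ProbabilityTheory.gammaPDFReal, if_pos h.le]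
    simp [mul_assoc]

lemma lintegral_Ici_exp_neg {a : ℝ} :
    ∫⁻ r in Set.Ici a, ENNReal.ofReal (Real.exp (-r)) = ENNReal.ofReal (Real.exp (-a)) := by
  rw [setLIntegral_congr Ioi_ae_eq_Ici.symm, ← ofReal_integral_eq_lintegral_ofReal
    (integrableOn_exp_neg_Ioi a) (ae_of_all _ fun r => (Real.exp_pos _).le), integral_exp_neg_Ioi]

/-- The radial mixture of the uniform measure on `{permSup w ≤ 1}` with an independent
Gamma variable has density `exp (-permSup w)`. -/
lemma exists_lintegral_gamma_mul_norm (n : ℕ) {w : ℕ → ℝ} (hpos : ∀ i, 0 < w i) :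
    ∃ C : ℝ≥0∞, ∀ F : ℝ → ℝ≥0∞, Measurable F →
      ∫⁻ x in {x : Fin n → ℝ | permSup w x ≤ 1}, ∫⁻ r, F (r * ‖x‖)
          ∂(ProbabilityTheory.gammaMeasure (n + 1) 1)
        = C * ∫⁻ x : Fin n → ℝ, ENNReal.ofReal (Real.exp (-permSup w x)) * F ‖x‖ := by
  refine ⟨ENNReal.ofReal (1 / Real.Gamma (n + 1)), fun F hF => ?_⟩
  have hmD : MeasurableSet {x : Fin n → ℝ | permSup w x ≤ 1} :=
    measurableSet_le (measurable_permSup w) measurable_const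
  have hinner : ∀ r ∈ Set.Ioi (0 : ℝ),
      ∫⁻ x in {x : Fin n → ℝ | permSup w x ≤ 1},
          ENNReal.ofReal (r ^ n * Real.exp (-r)) * F (r * ‖x‖)
        = ∫⁻ y : Fin n → ℝ, {p : ℝ × (Fin n → ℝ) | permSup w p.2 ≤ p.1}.indicator
          (fun p => ENNReal.ofReal (Real.exp (-p.1)) * F ‖p.2‖) (r, y) := by
    intro r hr
    have hr : 0 < r := hr
    have hmG : Measurable ({y : Fin n → ℝ | permSup w y ≤ r}.indicator fun y => F ‖y‖) :=
      (hF.comp measurable_norm).indicator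
        (measurableSet_le (measurable_permSup w) measurable_const)
    have hscale : ∫⁻ x, {y : Fin n → ℝ | permSup w y ≤ r}.indicator (fun y => F ‖y‖) (r • x)
        = ENNReal.ofReal (r ^ n)⁻¹ *
          ∫⁻ y, {y : Fin n → ℝ | permSup w y ≤ r}.indicator (fun y => F ‖y‖) y := by
      rw [← lintegral_map hmG (measurable_const_smul r), Measure.map_addHaar_smul _ hr.ne',
        lintegral_smul_measure, smul_eq_mul, Module.finrank_fin_fun, abs_of_pos (by positivity)]
    rw [lintegral_const_mul _ (f := fun x : Fin n → ℝ => F (r * ‖x‖)) (by fun_prop), ← lintegral_indicator hmD]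
    have hind : ∀ x : Fin n → ℝ, {x : Fin n → ℝ | permSup w x ≤ 1}.indicator
        (fun x => F (r * ‖x‖)) x
        = {y : Fin n → ℝ | permSup w y ≤ r}.indicator (fun y => F ‖y‖) (r • x) := fun x => by
      simp [Set.indicator_apply, permSup_smul w hr.le, norm_smul, abs_of_pos hr, hr]
    rw [lintegral_congr hind, hscale, ← mul_assoc, ← ENNReal.ofReal_mul (by positivity),
      ← lintegral_const_mul _ hmG]
    refine lintegral_congr fun y => ?_
    have : r ^ n * Real.exp (-r) * (r ^ n)⁻¹ = Real.exp (-r) := by field_simp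
    by_cases h : permSup w y ≤ r <;> simp [h, this]
  have hmJ : Measurable ({p : ℝ × (Fin n → ℝ) | permSup w p.2 ≤ p.1}.indicator
      (fun p => ENNReal.ofReal (Real.exp (-p.1)) * F ‖p.2‖)) := by
    refine Measurable.indicator ?_ ?_
    · exact .mul (by fun_prop) (hF.comp measurable_snd.norm)
    · exact measurableSet_le ((measurable_permSup w).comp measurable_snd) measurable_fst
  have hmI : Measurable fun p : (Fin n → ℝ) × ℝ =>
      ENNReal.ofReal (p.2 ^ n * Real.exp (-p.2)) * F (p.2 * ‖p.1‖) :=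
    .mul (by fun_prop) (hF.comp (by fun_prop))
  simp_rw [fun x : Fin n → ℝ => lintegral_gammaMeasure_natCast_add_one n
    (g := fun r => F (r * ‖x‖)) (hF.comp (by fun_prop))]
  rw [lintegral_const_mul _ hmI.lintegral_prod_right',
    lintegral_lintegral_swap hmI.aemeasurable, setLIntegral_congr_fun measurableSet_Ioi hinner,
    lintegral_lintegral_swap
      (f := fun r y => {p : ℝ × (Fin n → ℝ) | permSup w p.2 ≤ p.1}.indicator
        (fun p => ENNReal.ofReal (Real.exp (-p.1)) * F ‖p.2‖) (r, y)) hmJ.aemeasurable]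
  congr 1
  refine lintegral_congr fun y => ?_
  have hN := permSup_nonneg (fun i => (hpos i).le) y
  have hset : ∀ r, {p : ℝ × (Fin n → ℝ) | permSup w p.2 ≤ p.1}.indicator
      (fun p => ENNReal.ofReal (Real.exp (-p.1)) * F ‖p.2‖) (r, y)
      = (Set.Ici (permSup w y)).indicator (fun r => ENNReal.ofReal (Real.exp (-r)) * F ‖y‖) r :=
    fun r => by simp [Set.indicator_apply]
  have hae : (Set.Ici (permSup w y) ∩ Set.Ioi 0 : Set ℝ) =ᵐ[volume] Set.Ici (permSup w y) := by
    filter_upwards [Measure.ae_ne volume (0 : ℝ)] with r hr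
    exact propext ⟨And.left, fun h => ⟨h, lt_of_le_of_ne (hN.trans h) hr.symm⟩⟩
  rw [lintegral_congr hset, setLIntegral_indicator measurableSet_Ici, setLIntegral_congr hae,
    lintegral_mul_const _ (by fun_prop), lintegral_Ici_exp_neg]

/-- If `x` is uniform on `{permSup w ≤ 1}` and `r` is an independent `Gamma(n+1)` variable, then
`r * ‖x‖` is distributed as `∑ E_j / K_{j+1}` with independent standard exponentials `E_j`. -/
lemma map_mul_norm_prod_gammaMeasure {n : ℕ} (hn : 0 < n) {w : ℕ → ℝ} (hw : Antitone w)
    (hpos : ∀ i, 0 < w i) (μ : Measure (Fin n → ℝ)) [IsProbabilityMeasure μ] (a : ℝ≥0∞)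
    (hμ : μ = a • volume.restrict {x : Fin n → ℝ | permSup w x ≤ 1}) :
    (μ.prod (ProbabilityTheory.gammaMeasure (n + 1) 1)).map (fun p => p.2 * ‖p.1‖)
      = (Measure.pi fun _ : Fin n => ProbabilityTheory.expMeasure 1).map (gapSum w) := by
  have : IsProbabilityMeasure (ProbabilityTheory.gammaMeasure (n + 1) 1) :=
    ProbabilityTheory.isProbabilityMeasure_gammaMeasure (by positivity) one_pos
  obtain ⟨c₁, h₁⟩ := exists_lintegral_norm_mul_exp_permSup hn hw hpos
  obtain ⟨c₂, h₂⟩ := exists_lintegral_gamma_mul_norm n hpos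
  have hm : Measurable fun p : (Fin n → ℝ) × ℝ => p.2 * ‖p.1‖ := by fun_prop
  have key : ∀ F : ℝ → ℝ≥0∞, Measurable F →
      ∫⁻ p, F (p.2 * ‖p.1‖) ∂(μ.prod (ProbabilityTheory.gammaMeasure (n + 1) 1))
        = a * (c₂ * c₁) * ∫⁻ z, F (gapSum w z)
          ∂(Measure.pi fun _ : Fin n => ProbabilityTheory.expMeasure 1) := by
    intro F hF
    rw [lintegral_prod (fun p => F (p.2 * ‖p.1‖)) (hF.comp hm).aemeasurable, hμ, lintegral_smul_measure, smul_eq_mul,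
      h₂ F hF, h₁ F hF, mul_assoc, mul_assoc]
  have hone : a * (c₂ * c₁) = 1 := by
    simpa using (key (fun _ => 1) measurable_const).symm
  ext s hs
  have := key (s.indicator 1) (measurable_one.indicator hs)
  rw [hone, one_mul, ← lintegral_map (measurable_one.indicator hs) hm,
    ← lintegral_map (measurable_one.indicator hs) (measurable_gapSum w),
    lintegral_indicator_one hs, lintegral_indicator_one hs] at this
  exact this

lemma integral_expMeasure_one (f : ℝ → ℂ) :
    ∫ x, f x ∂(ProbabilityTheory.expMeasure 1) = ∫ x in Set.Ioi 0, (Real.exp (-x) : ℂ) * f x := by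
  have hlaw : ProbabilityTheory.expMeasure 1
      = volume.withDensity (ProbabilityTheory.exponentialPDF 1) := rfl
  have hmeas : Measurable (ProbabilityTheory.exponentialPDF 1) :=
    (ProbabilityTheory.measurable_exponentialPDFReal 1).ennreal_ofReal
  rw [hlaw, integral_withDensity_eq_integral_toReal_smul hmeas
    (ae_of_all _ fun _ => ENNReal.ofReal_lt_top), ← integral_indicator measurableSet_Ioi]
  refine integral_congr_ae ?_
  filter_upwards [compl_mem_ae_iff.2 (measure_singleton (μ := volume) (0 : ℝ))] with x hx
  rcases lt_or_gt_of_ne (show x ≠ 0 from hx) with h | h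
  · simp [ProbabilityTheory.exponentialPDF_of_neg h, h.le]
  · rw [Set.indicator_of_mem (by exact h), ProbabilityTheory.exponentialPDF_of_nonneg h.le,
      ENNReal.toReal_ofReal (by positivity)]
    simp

lemma integral_cexp_centered_expMeasure_one (u : ℝ) :
    ∫ x : ℝ, Complex.exp ((u * (x - 1) : ℝ) * Complex.I) ∂(ProbabilityTheory.expMeasure 1)
      = Complex.exp (-(u * Complex.I)) / (1 - u * Complex.I) := by
  rw [integral_expMeasure_one]
  have h (x : ℝ) : (Real.exp (-x) : ℂ) * Complex.exp ((u * (x - 1) : ℝ) * Complex.I)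
      = Complex.exp (-(u * Complex.I)) * Complex.exp ((-1 + u * Complex.I) * x) := by
    rw [Complex.ofReal_exp, ← Complex.exp_add, ← Complex.exp_add]
    push_cast
    ring_nf
  simp_rw [h]
  rw [integral_const_mul, integral_exp_mul_complex_Ioi (by simp)]
  simp only [Complex.ofReal_zero, mul_zero, Complex.exp_zero]
  rw [div_eq_mul_inv _ (1 - _), neg_div, one_div, ← inv_neg]
  ring_nf

lemma integral_cexp_sum_centered_pi_expMeasure_one {n : ℕ} (b : Fin n → ℝ) :
    ∫ z : Fin n → ℝ, Complex.exp ((∑ j, b j * (z j - 1) : ℝ) * Complex.I)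
        ∂(Measure.pi fun _ : Fin n => ProbabilityTheory.expMeasure 1)
      = ∏ j, Complex.exp (-(b j * Complex.I)) / (1 - b j * Complex.I) := by
  simp_rw [Complex.ofReal_sum, sum_mul, Complex.exp_sum]
  rw [integral_fintype_prod_eq_prod
    (fun j x => Complex.exp ((b j * (x - 1) : ℝ) * Complex.I))]
  simp_rw [integral_cexp_centered_expMeasure_one]

lemma one_le_norm_one_sub_mul_I (u : ℝ) : 1 ≤ ‖1 - u * Complex.I‖ := by
  simpa using Complex.abs_re_le_norm (1 - u * Complex.I)

lemma norm_cexp_div_le_one (u : ℝ) :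
    ‖Complex.exp (-(u * Complex.I)) / (1 - u * Complex.I)‖ ≤ 1 := by
  rw [norm_div, ← neg_mul, ← Complex.ofReal_neg, Complex.norm_exp_ofReal_mul_I]
  exact div_le_one_of_le₀ (one_le_norm_one_sub_mul_I u) (norm_nonneg _)

lemma norm_cexp_neg_sq_le_one (u : ℝ) : ‖Complex.exp (-(u ^ 2 / 2 : ℝ))‖ ≤ 1 := by
  rw [Complex.norm_exp, Complex.neg_re, Complex.ofReal_re, Real.exp_le_one_iff, neg_nonpos]
  positivity

lemma norm_cexp_div_sub_cexp_le {u : ℝ} (hu : |u| ≤ 1) :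
    ‖Complex.exp (-(u * Complex.I)) / (1 - u * Complex.I) - Complex.exp (-(u ^ 2 / 2 : ℝ))‖
      ≤ 2 * |u| ^ 3 := by
  have h1 := one_le_norm_one_sub_mul_I u
  have hne : (1 - u * Complex.I : ℂ) ≠ 0 := norm_pos_iff.1 (by linarith)
  have hub : ‖1 - u * Complex.I‖ ≤ 2 := by
    refine (norm_sub_le _ _).trans ?_
    simp only [norm_one, norm_mul, Complex.norm_real, Complex.norm_I, Real.norm_eq_abs]
    linarith
  have hA : ‖Complex.exp (-(u * Complex.I)) - (1 - u * Complex.I - u ^ 2 / 2)‖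
      ≤ |u| ^ 3 * (2 / 9) := by
    have := Complex.exp_bound (x := -(u * Complex.I)) (by simpa using hu) (n := 3) (by norm_num)
    simp only [sum_range_succ, sum_range_zero, Nat.factorial, norm_neg, norm_mul, Complex.norm_real,
      Complex.norm_I, Real.norm_eq_abs, mul_one] at this
    convert! this using 1
    · congr 1
      rw [neg_sq, mul_pow, Complex.I_sq]
      push_cast
      ring
    · norm_num
  have hB : ‖Complex.exp (-(u ^ 2 / 2 : ℝ)) - 1 - (-(u ^ 2 / 2 : ℝ))‖ ≤ |u| ^ 3 / 4 := by
    have hle : |u| ^ 4 ≤ |u| ^ 3 := pow_le_pow_of_le_one (abs_nonneg u) hu (by norm_num)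
    have hsq : u ^ 2 = |u| ^ 2 := (sq_abs u).symm
    have hn : ‖(-(u ^ 2 / 2 : ℝ) : ℂ)‖ = |u| ^ 2 / 2 := by
      rw [norm_neg, Complex.norm_real, Real.norm_eq_abs, abs_of_nonneg (by positivity), hsq]
    refine (Complex.norm_exp_sub_one_sub_id_le ?_).trans ?_
    · rw [hn]
      nlinarith [abs_nonneg u]
    · rw [hn]
      linarith [show (|u| ^ 2 / 2) ^ 2 = |u| ^ 4 / 4 by ring]
  have hdiv : Complex.exp (-(u * Complex.I)) / (1 - u * Complex.I)
      - Complex.exp (-(u ^ 2 / 2 : ℝ))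
      = ((Complex.exp (-(u * Complex.I)) - (1 - u * Complex.I - u ^ 2 / 2))
        - (1 - u * Complex.I) * (Complex.exp (-(u ^ 2 / 2 : ℝ)) - 1 - (-(u ^ 2 / 2 : ℝ)))
        + (-(u ^ 3 / 2 : ℝ)) * Complex.I) / (1 - u * Complex.I) := by
    rw [eq_div_iff hne, sub_mul, div_mul_cancel₀ _ hne]
    push_cast
    ring
  rw [hdiv, norm_div]
  refine (div_le_self (norm_nonneg _) h1).trans ?_
  refine (norm_add_le _ _).trans ((add_le_add_left (norm_sub_le _ _) _).trans ?_)
  rw [norm_mul, norm_mul _ Complex.I, norm_neg, Complex.norm_real, Complex.norm_I,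
    Real.norm_eq_abs, abs_div, abs_pow, abs_two]
  have := mul_le_mul hub hB (norm_nonneg _) (by norm_num)
  nlinarith [pow_nonneg (abs_nonneg u) 3]

lemma norm_prod_sub_prod_le {ι : Type*} (s : Finset ι) {f g : ι → ℂ}
    (hf : ∀ i ∈ s, ‖f i‖ ≤ 1) (hg : ∀ i ∈ s, ‖g i‖ ≤ 1) :
    ‖∏ i ∈ s, f i - ∏ i ∈ s, g i‖ ≤ ∑ i ∈ s, ‖f i - g i‖ := by
  classical
  induction s using Finset.induction_on with
  | empty => simp
  | insert a s ha ih =>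
    rw [prod_insert ha, prod_insert ha, sum_insert ha]
    have key : f a * ∏ i ∈ s, f i - g a * ∏ i ∈ s, g i
        = f a * (∏ i ∈ s, f i - ∏ i ∈ s, g i) + (f a - g a) * ∏ i ∈ s, g i := by ring
    have hs : ‖∏ i ∈ s, g i‖ ≤ 1 := by
      rw [norm_prod]
      exact prod_le_one (fun _ _ => norm_nonneg _) fun i hi => hg i (mem_insert_of_mem hi)
    have h1 := ih (fun i hi => hf i (mem_insert_of_mem hi)) fun i hi => hg i (mem_insert_of_mem hi)
    rw [key]
    refine (norm_add_le _ _).trans ?_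
    rw [norm_mul, norm_mul]
    have h2 := mul_le_mul (hf a (mem_insert_self a s)) h1 (norm_nonneg _) zero_le_one
    have h3 := mul_le_mul_of_nonneg_left hs (norm_nonneg (f a - g a))
    linarith

/-- Convergence of characteristic functions of normalized weighted sums of centered exponential
random variables. -/
lemma tendsto_prod_cexp_div {b : ℕ → ℝ} {s : ℕ → ℝ} {v C : ℝ} (hb : ∀ j, |b j| ≤ 1)
    (hs : Tendsto s atTop atTop)
    (hb3 : ∀ n, ∑ j ∈ range n, |b j| ^ 3 ≤ C)
    (hb2 : Tendsto (fun n => (∑ j ∈ range n, b j ^ 2) / s n ^ 2) atTop (nhds v)) (t : ℝ) :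
    Tendsto (fun n => ∏ j : Fin n, Complex.exp (-((t * (b j / s n) : ℝ) * Complex.I))
        / (1 - (t * (b j / s n) : ℝ) * Complex.I))
      atTop (nhds (Complex.exp (-(t ^ 2 * v / 2 : ℝ)))) := by
  have hexp : Tendsto (fun n => ∏ j : Fin n, Complex.exp (-((t * (b j / s n)) ^ 2 / 2 : ℝ)))
      atTop (nhds (Complex.exp (-(t ^ 2 * v / 2 : ℝ)))) := by
    have h1 : Tendsto (fun n => -(t ^ 2 * ((∑ j ∈ range n, b j ^ 2) / s n ^ 2) / 2)) atTop
        (nhds (-(t ^ 2 * v / 2))) := ((hb2.const_mul _).div_const 2).neg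
    have h2 := (Complex.continuous_exp.tendsto _).comp
      ((Complex.continuous_ofReal.tendsto _).comp h1)
    rw [Complex.ofReal_neg] at h2
    refine h2.congr fun n => ?_
    simp only [Function.comp]
    rw [← Complex.exp_sum, ← Fin.sum_univ_eq_sum_range]
    simp only [← Complex.ofReal_neg, ← Complex.ofReal_sum]
    rw [sum_div, mul_sum, sum_div, ← sum_neg_distrib]
    congr 2
    exact sum_congr rfl fun j _ => by ring
  refine hexp.congr_dist ?_
  have hlim : Tendsto (fun n => 2 * |t| ^ 3 * C * ((s n)⁻¹) ^ 3) atTop (nhds 0) := by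
    simpa using (hs.inv_tendsto_atTop.pow 3).const_mul (2 * |t| ^ 3 * C)
  refine squeeze_zero' (Eventually.of_forall fun _ => dist_nonneg) ?_ hlim
  filter_upwards [hs.eventually_ge_atTop (max 1 |t|)] with n hn
  have hs1 : 0 < s n := by linarith [le_max_left 1 |t|]
  have hts : |t| ≤ s n := (le_max_right 1 |t|).trans hn
  have habs (j : ℕ) : |t * (b j / s n)| = |t| * |b j| * (s n)⁻¹ := by
    rw [abs_mul, abs_div, abs_of_pos hs1]
    ring
  have hu (j : ℕ) : |t * (b j / s n)| ≤ 1 := by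
    rw [habs, ← div_eq_mul_inv, div_le_one hs1]
    nlinarith [hb j, abs_nonneg t, abs_nonneg (b j)]
  rw [dist_comm, dist_eq_norm]
  refine (norm_prod_sub_prod_le _ (fun j _ => norm_cexp_div_le_one _)
    fun j _ => norm_cexp_neg_sq_le_one _).trans ?_
  refine (sum_le_sum fun (j : Fin n) _ => norm_cexp_div_sub_cexp_le (hu j)).trans ?_
  simp_rw [habs, mul_pow]
  rw [Fin.sum_univ_eq_sum_range (fun j => 2 * (|t| ^ 3 * |b j| ^ 3 * (s n)⁻¹ ^ 3)) n]
  calc ∑ j ∈ range n, 2 * (|t| ^ 3 * |b j| ^ 3 * (s n)⁻¹ ^ 3)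
      = 2 * |t| ^ 3 * (∑ j ∈ range n, |b j| ^ 3) * (s n)⁻¹ ^ 3 := by
        rw [mul_sum, sum_mul]
        exact sum_congr rfl fun j _ => by ring
    _ ≤ 2 * |t| ^ 3 * C * (s n)⁻¹ ^ 3 := by
        gcongr
        exact hb3 n

lemma partialSum_rpow_eq_kappa2 (k : ℕ) :
    partialSum (fun i => ((i : ℝ) + 1) ^ (-(1 / 2) : ℝ)) k = kappa2 k := rfl

lemma rpow_neg_half_eq_inv_sqrt (i : ℕ) : ((i : ℝ) + 1) ^ (-(1 / 2) : ℝ) = (√((i : ℝ) + 1))⁻¹ := by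
  rw [Real.rpow_neg (by positivity), Real.sqrt_eq_rpow]

lemma kappa2_succ (k : ℕ) : kappa2 (k + 1) = kappa2 k + (√((k : ℝ) + 1))⁻¹ := by
  rw [kappa2, sum_range_succ, rpow_neg_half_eq_inv_sqrt, kappa2]

lemma sqrt_le_kappa2 (k : ℕ) : √k ≤ kappa2 k := by
  induction k with
  | zero => simp [kappa2]
  | succ k ih =>
    rw [kappa2_succ]
    push_cast
    have h0 := Real.sqrt_nonneg (k : ℝ)
    have h1 : 0 < √((k : ℝ) + 1) := by positivity
    have h2 : √(k : ℝ) ≤ √((k : ℝ) + 1) := Real.sqrt_le_sqrt (by linarith)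
    have h3 : √((k : ℝ) + 1) - √(k : ℝ) ≤ (√((k : ℝ) + 1))⁻¹ := by
      rw [← one_div, le_div_iff₀ h1]
      nlinarith [Real.sq_sqrt (show (0 : ℝ) ≤ k by positivity),
        Real.sq_sqrt (show (0 : ℝ) ≤ (k : ℝ) + 1 by positivity)]
    linarith

lemma kappa2_le (k : ℕ) : kappa2 k ≤ 2 * √k := by
  induction k with
  | zero => simp [kappa2]
  | succ k ih =>
    rw [kappa2_succ]
    push_cast
    have h0 := Real.sqrt_nonneg (k : ℝ)
    have h1 : 0 < √((k : ℝ) + 1) := by positivity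
    have h3 : (√((k : ℝ) + 1))⁻¹ ≤ 2 * (√((k : ℝ) + 1) - √(k : ℝ)) := by
      rw [← one_div, div_le_iff₀ h1]
      nlinarith [Real.sq_sqrt (show (0 : ℝ) ≤ k by positivity),
        Real.sq_sqrt (show (0 : ℝ) ≤ (k : ℝ) + 1 by positivity),
        sq_nonneg (√((k : ℝ) + 1) - √(k : ℝ))]
    linarith

lemma two_mul_sqrt_sub_two_le_kappa2 (k : ℕ) : 2 * √((k : ℝ) + 1) - 2 ≤ kappa2 k := by
  induction k with
  | zero => simp [kappa2]
  | succ k ih =>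
    rw [kappa2_succ]
    push_cast
    have h0 : 0 < √((k : ℝ) + 1) := by positivity
    have h3 : 2 * (√((k : ℝ) + 1 + 1) - √((k : ℝ) + 1)) ≤ (√((k : ℝ) + 1))⁻¹ := by
      rw [← one_div, le_div_iff₀ h0]
      nlinarith [Real.sq_sqrt (show (0 : ℝ) ≤ (k : ℝ) + 1 by positivity),
        Real.sq_sqrt (show (0 : ℝ) ≤ (k : ℝ) + 1 + 1 by positivity),
        sq_nonneg (√((k : ℝ) + 1 + 1) - √((k : ℝ) + 1))]
    linarith

lemma kappa2_succ_pos (k : ℕ) : 0 < kappa2 (k + 1) :=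
  (by positivity : 0 < √((k + 1 : ℕ) : ℝ)).trans_le (sqrt_le_kappa2 _)

lemma summable_inv_sqrt_cube : Summable fun j : ℕ => (√((j + 1 : ℕ) : ℝ) ^ 3)⁻¹ := by
  have h : Summable fun j : ℕ => ((j : ℝ) ^ (3 / 2 : ℝ))⁻¹ :=
    Real.summable_nat_rpow_inv.2 (by norm_num)
  refine ((summable_nat_add_iff 1).2 h).congr fun j => ?_
  rw [Real.sqrt_eq_rpow, ← Real.rpow_natCast, ← Real.rpow_mul (by positivity)]
  norm_num

lemma inv_kappa2_le (j : ℕ) : (kappa2 (j + 1))⁻¹ ≤ (√((j + 1 : ℕ) : ℝ))⁻¹ :=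
  inv_anti₀ (by positivity) (sqrt_le_kappa2 _)

lemma abs_inv_kappa2_le_one (j : ℕ) : |(kappa2 (j + 1))⁻¹| ≤ 1 := by
  rw [abs_of_pos (inv_pos.2 (kappa2_succ_pos j))]
  refine inv_le_one_of_one_le₀ (le_trans ?_ (sqrt_le_kappa2 _))
  rw [Real.one_le_sqrt]
  simp

lemma sum_abs_inv_kappa2_cube_le (n : ℕ) :
    ∑ j ∈ range n, |(kappa2 (j + 1))⁻¹| ^ 3 ≤ ∑' j : ℕ, (√((j + 1 : ℕ) : ℝ) ^ 3)⁻¹ := by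
  refine le_trans (sum_le_sum fun j _ => ?_)
    (summable_inv_sqrt_cube.sum_le_tsum (range n) fun j _ => by positivity)
  rw [abs_of_pos (inv_pos.2 (kappa2_succ_pos j)), ← inv_pow]
  exact pow_le_pow_left₀ (inv_pos.2 (kappa2_succ_pos j)).le (inv_kappa2_le j) 3

lemma abs_inv_kappa2_sq_sub_le (j : ℕ) :
    |(kappa2 (j + 1))⁻¹ ^ 2 - 4⁻¹ * ((j + 1 : ℕ) : ℝ)⁻¹| ≤ 2 * (√((j + 1 : ℕ) : ℝ) ^ 3)⁻¹ := by
  have hk := kappa2_succ_pos j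
  have h1 := sqrt_le_kappa2 (j + 1)
  have h2 := kappa2_le (j + 1)
  have h3 : 2 * √((j + 1 : ℕ) : ℝ) - 2 ≤ kappa2 (j + 1) :=
    le_trans (by gcongr; simp) (two_mul_sqrt_sub_two_le_kappa2 (j + 1))
  have hr : 0 < √((j + 1 : ℕ) : ℝ) := by positivity
  have hsq : ((j + 1 : ℕ) : ℝ) = √((j + 1 : ℕ) : ℝ) ^ 2 := (Real.sq_sqrt (by positivity)).symm
  set r := √((j + 1 : ℕ) : ℝ)
  set k := kappa2 (j + 1)
  rw [hsq]
  have heq : k⁻¹ ^ 2 - 4⁻¹ * (r ^ 2)⁻¹ = (2 * r - k) * (2 * r + k) / (4 * r ^ 2 * k ^ 2) := by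
    field_simp
    ring
  rw [heq, abs_of_nonneg (div_nonneg (mul_nonneg (by linarith) (by linarith)) (by positivity)),
    div_le_iff₀ (by positivity)]
  have h4 : (2 * r - k) * (2 * r + k) ≤ 2 * (4 * r) :=
    mul_le_mul (by linarith) (by linarith) (by linarith) (by norm_num)
  have h5 : 2 * (r ^ 3)⁻¹ * (4 * r ^ 2 * k ^ 2) = 8 * (k ^ 2 / r) := by
    field_simp
    ring
  rw [h5]
  have h6 : r ≤ k ^ 2 / r := by
    rw [le_div_iff₀ hr]
    nlinarith
  linarith

lemma tendsto_sqrt_log_atTop : Tendsto (fun n : ℕ => √(Real.log n)) atTop atTop :=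
  Real.tendsto_sqrt_atTop.comp (Real.tendsto_log_atTop.comp tendsto_natCast_atTop_atTop)

lemma tendsto_harmonic_div_log :
    Tendsto (fun n : ℕ => (harmonic n : ℝ) / Real.log n) atTop (nhds 1) := by
  have hlog : Tendsto (fun n : ℕ => Real.log n) atTop atTop :=
    Real.tendsto_log_atTop.comp tendsto_natCast_atTop_atTop
  have h := (Real.tendsto_harmonic_sub_log.div_atTop hlog).add_const 1
  rw [zero_add] at h
  refine h.congr' ?_
  filter_upwards [hlog.eventually_gt_atTop 0] with n hn
  field_simp
  ring

lemma tendsto_sum_inv_kappa2_sq_div_log :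
    Tendsto (fun n : ℕ => (∑ j ∈ range n, (kappa2 (j + 1))⁻¹ ^ 2) / √(Real.log n) ^ 2)
      atTop (nhds (1 / 4)) := by
  have hlog : Tendsto (fun n : ℕ => Real.log n) atTop atTop :=
    Real.tendsto_log_atTop.comp tendsto_natCast_atTop_atTop
  have hmain := tendsto_harmonic_div_log.const_mul (1 / 4)
  rw [mul_one] at hmain
  refine hmain.congr_dist ?_
  have hlim := (tendsto_const_nhds
    (x := 2 * ∑' j : ℕ, (√((j + 1 : ℕ) : ℝ) ^ 3)⁻¹)).div_atTop hlog
  refine squeeze_zero' (Eventually.of_forall fun _ => dist_nonneg) ?_ hlim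
  filter_upwards [hlog.eventually_gt_atTop 0] with n hn
  have hH : (harmonic n : ℝ) = ∑ j ∈ range n, ((j + 1 : ℕ) : ℝ)⁻¹ := by
    simp [harmonic]
  rw [Real.sq_sqrt hn.le, dist_comm, Real.dist_eq, hH, ← mul_div_assoc, ← sub_div, abs_div,
    abs_of_pos hn]
  gcongr
  rw [mul_sum, ← sum_sub_distrib, ← tsum_mul_left]
  refine (abs_sum_le_sum_abs _ _).trans (le_trans (sum_le_sum fun j _ => ?_)
    ((summable_inv_sqrt_cube.mul_left 2).sum_le_tsum (range n) fun j _ => by positivity))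
  rw [one_div]
  exact abs_inv_kappa2_sq_sub_le j

lemma sum_inv_kappa2_le (n : ℕ) : ∑ j ∈ range n, (kappa2 (j + 1))⁻¹ ≤ 2 * √n := by
  refine le_trans (sum_le_sum fun j _ => inv_kappa2_le j) (le_trans (le_of_eq ?_) (kappa2_le n))
  rw [kappa2]
  exact sum_congr rfl fun j _ => by rw [rpow_neg_half_eq_inv_sqrt]; push_cast; rfl

/-- The Gamma distribution of shape `n + 1` and rate `1`. -/
def gammaSucc (n : ℕ) : Measure ℝ := ProbabilityTheory.gammaMeasure (n + 1) 1

instance isProbabilityMeasure_gammaSucc (n : ℕ) : IsProbabilityMeasure (gammaSucc n) :=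
  ProbabilityTheory.isProbabilityMeasure_gammaMeasure (by positivity) one_pos

lemma ae_pos_gammaSucc (n : ℕ) : ∀ᵐ r ∂gammaSucc n, 0 < r := by
  rw [ae_iff, ← lintegral_indicator_one (by measurability), gammaSucc,
    lintegral_gammaMeasure_natCast_add_one n (measurable_one.indicator (by measurability)),
    setLIntegral_congr_fun (g := fun _ => 0) measurableSet_Ioi fun r hr => ?_]
  · simp
  · simp [show 0 < r from hr]

lemma lintegral_pow_gammaSucc (n k : ℕ) :
    ∫⁻ r, ENNReal.ofReal (r ^ k) ∂gammaSucc n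
      = ENNReal.ofReal ((n + k).factorial / n.factorial) := by
  have hint : IntegrableOn (fun r : ℝ => r ^ (n + k) * Real.exp (-r)) (Set.Ioi 0) := by
    have := Real.GammaIntegral_convergent (s := (n + k : ℕ) + 1) (by positivity)
    simpa [mul_comm, ← Nat.cast_add] using this
  have hval : ∫ r in Set.Ioi (0 : ℝ), r ^ (n + k) * Real.exp (-r) = (n + k).factorial := by
    rw [← Real.Gamma_nat_eq_factorial, Real.Gamma_eq_integral (by positivity)]
    simp [mul_comm, ← Real.rpow_natCast]
  rw [gammaSucc, lintegral_gammaMeasure_natCast_add_one n (by fun_prop),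
    setLIntegral_congr_fun (g := fun r => ENNReal.ofReal (r ^ (n + k) * Real.exp (-r)))
      measurableSet_Ioi fun r hr => ?_, ← ofReal_integral_eq_lintegral_ofReal hint, hval,
    Real.Gamma_nat_eq_factorial, ← ENNReal.ofReal_mul (by positivity)]
  · congr 1
    ring
  · filter_upwards [ae_restrict_mem measurableSet_Ioi] with r hr
    have : 0 < r := hr
    positivity
  · have : 0 < r := hr
    simp only
    rw [← ENNReal.ofReal_mul (by positivity)]
    ring_nf

lemma integrable_pow_gammaSucc (n k : ℕ) : Integrable (fun r => r ^ k) (gammaSucc n) := by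
  refine ⟨by fun_prop, ?_⟩
  rw [hasFiniteIntegral_iff_ofReal, lintegral_pow_gammaSucc]
  · exact ENNReal.ofReal_lt_top
  · filter_upwards [ae_pos_gammaSucc n] with r hr
    positivity

lemma integral_pow_gammaSucc (n k : ℕ) :
    ∫ r, r ^ k ∂gammaSucc n = (n + k).factorial / n.factorial := by
  rw [integral_eq_lintegral_of_nonneg_ae _ (by fun_prop), lintegral_pow_gammaSucc,
    ENNReal.toReal_ofReal (by positivity)]
  filter_upwards [ae_pos_gammaSucc n] with r hr
  positivity

lemma lintegral_sq_gammaSucc (n : ℕ) :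
    ∫⁻ r, ENNReal.ofReal (r ^ 2) ∂gammaSucc n = ENNReal.ofReal ((n + 1) * (n + 2)) := by
  rw [lintegral_pow_gammaSucc, Nat.factorial_succ, Nat.factorial_succ]
  congr 1
  push_cast
  field_simp
  ring

lemma lintegral_sq_div_sub_one_gammaSucc {n : ℕ} (hn : 0 < n) :
    ∫⁻ r, ENNReal.ofReal ((1 - r / n) ^ 2) ∂gammaSucc n
      = ENNReal.ofReal ((n + 2) / (n : ℝ) ^ 2) := by
  have h1 : Integrable (fun r : ℝ => 1 - 2 / n * r ^ 1) (gammaSucc n) :=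
    (integrable_const 1).sub ((integrable_pow_gammaSucc n 1).const_mul _)
  have h2 : Integrable (fun r : ℝ => 1 / (n : ℝ) ^ 2 * r ^ 2) (gammaSucc n) :=
    (integrable_pow_gammaSucc n 2).const_mul _
  have heq : (fun r : ℝ => (1 - r / n) ^ 2)
      = fun r => (1 - 2 / n * r ^ 1) + 1 / (n : ℝ) ^ 2 * r ^ 2 := by
    ext r
    ring
  rw [← ofReal_integral_eq_lintegral_ofReal (heq ▸ h1.add h2) (ae_of_all _ fun _ => sq_nonneg _),
    heq, integral_add h1 h2, integral_sub (integrable_const 1)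
      ((integrable_pow_gammaSucc n 1).const_mul _), integral_const_mul, integral_const_mul,
    integral_pow_gammaSucc, integral_pow_gammaSucc, Nat.factorial_succ, Nat.factorial_succ]
  congr 1
  have : (0 : ℝ) < n := by exact_mod_cast hn
  have h0 : (n.factorial : ℝ) ≠ 0 := by positivity
  simp only [probReal_univ, integral_const, smul_eq_mul, Nat.factorial_succ]
  push_cast
  field_simp
  ring

lemma lintegral_sq_expMeasure_one :
    ∫⁻ r, ENNReal.ofReal (r ^ 2) ∂(ProbabilityTheory.expMeasure 1) = 2 := by
  have h : ProbabilityTheory.expMeasure 1 = gammaSucc 0 := by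
    simp [gammaSucc, ProbabilityTheory.expMeasure]
  rw [h, lintegral_sq_gammaSucc]
  norm_num

lemma gapSum_rpow_eq {n : ℕ} (z : Fin n → ℝ) :
    gapSum (fun i => ((i : ℝ) + 1) ^ (-(1 / 2) : ℝ)) z
      = ∑ j : Fin n, (kappa2 (j + 1))⁻¹ * z j := by
  rw [gapSum]
  exact sum_congr rfl fun j _ => by rw [partialSum_rpow_eq_kappa2, div_eq_inv_mul]

lemma lintegral_sq_sum_mul_pi_expMeasure_one_le {n : ℕ} {b : Fin n → ℝ} (hb : ∀ j, 0 ≤ b j) :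
    ∫⁻ z : Fin n → ℝ, ENNReal.ofReal ((∑ j, b j * z j) ^ 2)
        ∂(Measure.pi fun _ : Fin n => ProbabilityTheory.expMeasure 1)
      ≤ ENNReal.ofReal (2 * (∑ j, b j) ^ 2) := by
  have hs : 0 ≤ ∑ j, b j := sum_nonneg fun j _ => hb j
  have hcs (z : Fin n → ℝ) : ENNReal.ofReal ((∑ j, b j * z j) ^ 2)
      ≤ ENNReal.ofReal (∑ j, b j) * ∑ j, ENNReal.ofReal (b j) * ENNReal.ofReal (z j ^ 2) := by
    simp_rw [fun j => (ENNReal.ofReal_mul (hb j) (q := z j ^ 2)).symm]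
    rw [← ENNReal.ofReal_sum_of_nonneg fun j _ => mul_nonneg (hb j) (sq_nonneg _),
      ← ENNReal.ofReal_mul hs]
    exact ENNReal.ofReal_le_ofReal (sum_sq_le_sum_mul_sum_of_sq_le_mul _ (fun j _ => hb j)
      (fun j _ => mul_nonneg (hb j) (sq_nonneg _)) fun j _ => le_of_eq (by ring))
  have hone (j : Fin n) : ∫⁻ z : Fin n → ℝ, ENNReal.ofReal (z j ^ 2)
      ∂(Measure.pi fun _ : Fin n => ProbabilityTheory.expMeasure 1) = 2 := by
    rw [← lintegral_sq_expMeasure_one]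
    exact (measurePreserving_eval (fun _ : Fin n => ProbabilityTheory.expMeasure 1) j).lintegral_comp
      (f := fun r : ℝ => ENNReal.ofReal (r ^ 2)) (by fun_prop)
  refine (lintegral_mono hcs).trans (le_of_eq ?_)
  rw [lintegral_const_mul _ (by fun_prop), lintegral_finsetSum _ (fun j _ => by fun_prop)]
  simp_rw [fun j : Fin n => lintegral_const_mul (ENNReal.ofReal (b j))
    (f := fun z : Fin n → ℝ => ENNReal.ofReal (z j ^ 2))
    (μ := Measure.pi fun _ : Fin n => ProbabilityTheory.expMeasure 1) (by fun_prop), hone]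
  rw [← sum_mul, ← ENNReal.ofReal_sum_of_nonneg fun j _ => hb j,
    show (2 : ℝ≥0∞) = ENNReal.ofReal 2 by simp, ← ENNReal.ofReal_mul hs, ← ENNReal.ofReal_mul hs]
  congr 1
  ring

lemma scaledLorentzBall2_eq {n : ℕ} (hn : 0 < n) :
    scaledLorentzBall2 n = {x | permSup
      (fun i => (√(n : ℝ))⁻¹ * ((i : ℝ) + 1) ^ (-(1 / 2) : ℝ)) x ≤ 1} := by
  have hc : 0 < √(n : ℝ) := by positivity
  ext x
  rw [scaledLorentzBall2, ← Real.sqrt_eq_rpow, Set.mem_ofPred_eq,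
    permSup_smul_weight _ (inv_pos.2 hc).le]
  simp only [Set.mem_image, lorentzBall2, Set.mem_ofPred_eq, lorentzNorm2_eq_permSup]
  constructor
  · rintro ⟨y, hy, rfl⟩
    rwa [permSup_smul _ hc.le, inv_mul_cancel_left₀ hc.ne']
  · refine fun hx => ⟨(√(n : ℝ))⁻¹ • x, ?_, smul_inv_smul₀ hc.ne' x⟩
    rwa [permSup_smul _ (inv_pos.2 hc).le]

/-- If `X` is uniform on the scaled Lorentz ball and `R` is an independent Gamma variable of shape
`n + 1`, then `R ‖X‖` is distributed as `√n ∑ E_j / κ_2(j)` with i.i.d. exponential `E_j`. -/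
lemma map_mul_norm_prod_gammaSucc {n : ℕ} (hn : 0 < n) (μ : Measure (Fin n → ℝ))
    [IsProbabilityMeasure μ] (hμ : μ = unifOn (scaledLorentzBall2 n)) :
    (μ.prod (gammaSucc n)).map (fun p => p.2 * ‖p.1‖)
      = (Measure.pi fun _ : Fin n => ProbabilityTheory.expMeasure 1).map
        (fun z => √(n : ℝ) * ∑ j : Fin n, (kappa2 (j + 1))⁻¹ * z j) := by
  have hc : 0 < √(n : ℝ) := by positivity
  rw [scaledLorentzBall2_eq hn] at hμ
  rw [gammaSucc, map_mul_norm_prod_gammaMeasure hn ?_ ?_ μ _ hμ]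
  · congr 1
    ext z
    rw [← gapSum_rpow_eq, gapSum, gapSum, mul_sum]
    refine sum_congr rfl fun j _ => ?_
    have hp : partialSum (fun i => (√(n : ℝ))⁻¹ * ((i : ℝ) + 1) ^ (-(1 / 2) : ℝ)) (j + 1)
        = (√(n : ℝ))⁻¹ * kappa2 (j + 1) := by
      rw [partialSum, ← mul_sum, kappa2]
    rw [hp, partialSum_rpow_eq_kappa2]
    have := kappa2_succ_pos j
    field_simp
  · intro i j hij
    simp only [rpow_neg_half_eq_inv_sqrt]
    gcongr
  · intro i
    positivity

lemma mul_mu2n {n : ℕ} (hn : 0 < n) :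
    √(n : ℝ) * mu2n n = ∑ j ∈ range n, (kappa2 (j + 1))⁻¹ := by
  have hc : 0 < √(n : ℝ) := by positivity
  have hsq : (n : ℝ) = √(n : ℝ) ^ 2 := (Real.sq_sqrt (by positivity)).symm
  rw [mu2n, ← Real.sqrt_eq_rpow]
  simp_rw [div_eq_mul_inv (√(n : ℝ))]
  rw [← mul_sum]
  nth_rewrite 2 [hsq]
  field_simp

/-- The second moment of the sup norm of a uniform point of the scaled ball is bounded. -/
lemma lintegral_norm_sq_le {n : ℕ} (hn : 0 < n) (μ : Measure (Fin n → ℝ))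
    [IsProbabilityMeasure μ] (hμ : μ = unifOn (scaledLorentzBall2 n)) :
    ∫⁻ x, ENNReal.ofReal (‖x‖ ^ 2) ∂μ ≤ 8 := by
  have hn' : (0 : ℝ) < n := by exact_mod_cast hn
  have hprod : ∫⁻ p : (Fin n → ℝ) × ℝ, ENNReal.ofReal ((p.2 * ‖p.1‖) ^ 2) ∂(μ.prod (gammaSucc n))
      = (∫⁻ x, ENNReal.ofReal (‖x‖ ^ 2) ∂μ) * ENNReal.ofReal ((n + 1) * (n + 2)) := by
    rw [← lintegral_sq_gammaSucc, ← lintegral_prod_mul (by fun_prop) (by fun_prop)]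
    refine lintegral_congr fun p => ?_
    rw [← ENNReal.ofReal_mul (by positivity), mul_pow, mul_comm]
  have hlaw : ∫⁻ p : (Fin n → ℝ) × ℝ, ENNReal.ofReal ((p.2 * ‖p.1‖) ^ 2) ∂(μ.prod (gammaSucc n))
      ≤ ENNReal.ofReal (8 * ((n + 1) * (n + 2))) := by
    rw [← lintegral_map (f := fun y : ℝ => ENNReal.ofReal (y ^ 2)) (by fun_prop) (by fun_prop),
      map_mul_norm_prod_gammaSucc hn μ hμ, lintegral_map (by fun_prop) (by fun_prop)]
    simp_rw [mul_sum, ← mul_assoc]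
    refine (lintegral_sq_sum_mul_pi_expMeasure_one_le fun j =>
      mul_nonneg (Real.sqrt_nonneg _) (inv_pos.2 (kappa2_succ_pos j)).le).trans
      (ENNReal.ofReal_le_ofReal ?_)
    rw [← mul_sum, Fin.sum_univ_eq_sum_range (fun j => (kappa2 (j + 1))⁻¹) n, mul_pow,
      Real.sq_sqrt hn'.le]
    have h0 : 0 ≤ ∑ j ∈ range n, (kappa2 (j + 1))⁻¹ :=
      sum_nonneg fun j _ => (inv_pos.2 (kappa2_succ_pos j)).le
    have h1 := pow_le_pow_left₀ h0 (sum_inv_kappa2_le n) 2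
    rw [mul_pow, Real.sq_sqrt hn'.le] at h1
    nlinarith
  rw [hprod, ENNReal.ofReal_mul (p := 8) (by norm_num)] at hlaw
  have hpos : (0 : ℝ) < (n + 1) * (n + 2) := by positivity
  rw [ENNReal.mul_le_mul_iff_left (ENNReal.ofReal_pos.2 hpos).ne' ENNReal.ofReal_ne_top] at hlaw
  simpa using hlaw

lemma tendsto_charFun_sum_expMeasure_one (t : ℝ) :
    Tendsto (fun n : ℕ => charFun ((Measure.pi fun _ : Fin n => ProbabilityTheory.expMeasure 1).map
        (fun z => (∑ j : Fin n, (kappa2 (j + 1))⁻¹ * z j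
          - ∑ j ∈ range n, (kappa2 (j + 1))⁻¹) / √(Real.log n))) t)
      atTop (nhds (charFun (ProbabilityTheory.gaussianReal 0 (1 / 4)) t)) := by
  have h := tendsto_prod_cexp_div (b := fun j => (kappa2 (j + 1))⁻¹) abs_inv_kappa2_le_one
    tendsto_sqrt_log_atTop sum_abs_inv_kappa2_cube_le tendsto_sum_inv_kappa2_sq_div_log t
  convert! h using 2 with n
  · rw [charFun_apply_real, integral_map (Measurable.aemeasurable (by measurability)) (by fun_prop),
      ← integral_cexp_sum_centered_pi_expMeasure_one]
    refine integral_congr_ae (ae_of_all _ fun z => ?_)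
    simp only
    rw [← Fin.sum_univ_eq_sum_range (fun j => (kappa2 (j + 1))⁻¹) n, ← sum_sub_distrib,
      ← Complex.ofReal_mul, sum_div, mul_sum]
    congr 3
    exact sum_congr rfl fun j _ => by ring
  · rw [ProbabilityTheory.charFun_gaussianReal]
    congr 1
    push_cast
    simp
    ring

lemma tendstoInMeasure_zero_of_lintegral_sq {α : Type*} [MeasurableSpace α] {μ : Measure α}
    {f : ℕ → α → ℝ} (hf : ∀ n, AEMeasurable (f n) μ)
    (h : Tendsto (fun n => ∫⁻ a, ENNReal.ofReal (f n a ^ 2) ∂μ) atTop (nhds 0)) :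
    TendstoInMeasure μ f atTop 0 := by
  rw [tendstoInMeasure_iff_norm]
  intro ε hε
  have hε' : ENNReal.ofReal (ε ^ 2) ≠ 0 := (ENNReal.ofReal_pos.2 (by positivity)).ne'
  have hlim := ENNReal.Tendsto.div_const h (b := ENNReal.ofReal (ε ^ 2)) (Or.inr hε')
  rw [ENNReal.zero_div] at hlim
  refine tendsto_of_tendsto_of_tendsto_of_le_of_le tendsto_const_nhds hlim
    (fun _ => zero_le) fun n => ?_
  refine le_trans (measure_mono fun a ha => ?_)
    (meas_ge_le_lintegral_div ((hf n).pow_const 2).ennreal_ofReal hε' ENNReal.ofReal_ne_top)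
  have ha' : ε ≤ |f n a| := by simpa using ha
  rw [Set.mem_ofPred_eq, ← sq_abs (f n a)]
  exact ENNReal.ofReal_le_ofReal (pow_le_pow_left₀ hε.le ha' 2)

lemma tendsto_add_two_div_mul_log :
    Tendsto (fun n : ℕ => ENNReal.ofReal (8 * (((n : ℝ) + 2) / (n * Real.log n))))
      atTop (nhds 0) := by
  have hlog : Tendsto (fun n : ℕ => Real.log n) atTop atTop :=
    Real.tendsto_log_atTop.comp tendsto_natCast_atTop_atTop
  have h : Tendsto (fun n : ℕ => 24 / Real.log n) atTop (nhds 0) :=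
    tendsto_const_nhds.div_atTop hlog
  rw [← ENNReal.ofReal_zero]
  refine ENNReal.tendsto_ofReal (squeeze_zero' ?_ ?_ h)
  · filter_upwards [hlog.eventually_gt_atTop 0] with n hn
    positivity
  · filter_upwards [hlog.eventually_gt_atTop 0, eventually_ge_atTop 1] with n hn h1
    have h1' : (1 : ℝ) ≤ n := by exact_mod_cast h1
    rw [← mul_div_assoc, div_le_div_iff₀ (by positivity) hn]
    nlinarith

section Coupling

variable {Ω : Type*} [MeasurableSpace Ω] {P : Measure Ω} [IsProbabilityMeasure P]
  {X : (n : ℕ) → Ω → Fin n → ℝ}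

lemma map_prodMk_eval_infinitePi_gammaSucc (hXmeas : ∀ n, Measurable (X n)) (n : ℕ) :
    (P.prod (Measure.infinitePi gammaSucc)).map (fun p : Ω × (ℕ → ℝ) => (X n p.1, p.2 n))
      = (P.map (X n)).prod (gammaSucc n) := by
  have h := Measure.map_prod_map P (Measure.infinitePi gammaSucc) (hXmeas n)
    (measurable_pi_apply (X := fun _ : ℕ => ℝ) n)
  rw [Measure.infinitePi_map_eval] at h
  rw [h]
  rfl

/-- The rescaled norm with `‖X‖` replaced by `(R / n) ‖X‖`, where `R` is an independent Gamma
variable. -/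
def gammaFluctuation (X : (n : ℕ) → Ω → Fin n → ℝ) (n : ℕ) (p : Ω × (ℕ → ℝ)) : ℝ :=
  √(n : ℝ) / √(Real.log n) * (p.2 n * ‖X n p.1‖ / n - mu2n n)

lemma measurable_gammaFluctuation (hXmeas : ∀ n, Measurable (X n)) (n : ℕ) :
    Measurable (gammaFluctuation X n) := by
  have := hXmeas n
  unfold gammaFluctuation
  fun_prop

lemma map_gammaFluctuation (hXmeas : ∀ n, Measurable (X n))
    (hX : ∀ n, P.map (X n) = unifOn (scaledLorentzBall2 n)) {n : ℕ} (hn : 0 < n) :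
    (P.prod (Measure.infinitePi gammaSucc)).map (gammaFluctuation X n)
      = (Measure.pi fun _ : Fin n => ProbabilityTheory.expMeasure 1).map
        (fun z => (∑ j : Fin n, (kappa2 (j + 1))⁻¹ * z j
          - ∑ j ∈ range n, (kappa2 (j + 1))⁻¹) / √(Real.log n)) := by
  have hXn := hXmeas n
  have : IsProbabilityMeasure (P.map (X n)) := Measure.isProbabilityMeasure_map hXn.aemeasurable
  have hn' : (0 : ℝ) < n := by exact_mod_cast hn
  have hdecomp : gammaFluctuation X n
      = (fun y : ℝ => √(n : ℝ) / √(Real.log n) * (y / n - mu2n n)) ∘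
        (fun p : (Fin n → ℝ) × ℝ => p.2 * ‖p.1‖) ∘ fun p => (X n p.1, p.2 n) := rfl
  rw [hdecomp, ← Measure.map_map (by fun_prop) (by fun_prop),
    ← Measure.map_map (by fun_prop) (by fun_prop), map_prodMk_eval_infinitePi_gammaSucc hXmeas,
    map_mul_norm_prod_gammaSucc hn _ (hX n), Measure.map_map (by fun_prop) (by fun_prop)]
  congr 1
  ext z
  simp only [Function.comp]
  rw [← mul_mu2n hn, div_mul_eq_mul_div, mul_sub, ← mul_div_assoc, ← mul_assoc,
    Real.mul_self_sqrt hn'.le, mul_div_cancel_left₀ _ hn'.ne']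

lemma tendstoInDistribution_gammaFluctuation (hXmeas : ∀ n, Measurable (X n))
    (hX : ∀ n, P.map (X n) = unifOn (scaledLorentzBall2 n)) :
    TendstoInDistribution (gammaFluctuation X) atTop id
      (fun _ => P.prod (Measure.infinitePi gammaSucc))
      (ProbabilityTheory.gaussianReal 0 (1 / 4)) where
  forall_aemeasurable n := (measurable_gammaFluctuation hXmeas n).aemeasurable
  tendsto := by
    refine ProbabilityMeasure.tendsto_iff_tendsto_charFun.2 fun t => ?_
    simp only [ProbabilityMeasure.coe_mk, Measure.map_id]
    refine (tendsto_charFun_sum_expMeasure_one t).congr' ?_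
    filter_upwards [eventually_gt_atTop 0] with n hn
    rw [map_gammaFluctuation hXmeas hX hn]

lemma lintegral_sq_sub_gammaFluctuation_le (hXmeas : ∀ n, Measurable (X n))
    (hX : ∀ n, P.map (X n) = unifOn (scaledLorentzBall2 n)) {n : ℕ} (hn : 0 < n) :
    ∫⁻ p, ENNReal.ofReal ((√(n : ℝ) / √(Real.log n) * (‖X n p.1‖ - mu2n n)
        - gammaFluctuation X n p) ^ 2) ∂(P.prod (Measure.infinitePi gammaSucc))
      ≤ ENNReal.ofReal (8 * (((n : ℝ) + 2) / (n * Real.log n))) := by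
  have hXn := hXmeas n
  have : IsProbabilityMeasure (P.map (X n)) := Measure.isProbabilityMeasure_map hXn.aemeasurable
  have hn' : (0 : ℝ) < n := by exact_mod_cast hn
  have hlog : 0 ≤ Real.log n := Real.log_natCast_nonneg n
  have hpt (p : Ω × (ℕ → ℝ)) : ENNReal.ofReal ((√(n : ℝ) / √(Real.log n) * (‖X n p.1‖ - mu2n n)
      - gammaFluctuation X n p) ^ 2)
      = ENNReal.ofReal (n / Real.log n) *
        (ENNReal.ofReal (‖X n p.1‖ ^ 2) * ENNReal.ofReal ((1 - p.2 n / n) ^ 2)) := by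
    rw [← ENNReal.ofReal_mul (by positivity), ← ENNReal.ofReal_mul (by positivity),
      gammaFluctuation, ← mul_sub, mul_pow, div_pow, Real.sq_sqrt hn'.le, Real.sq_sqrt hlog]
    congr 1
    ring
  have hpair : ∫⁻ p, ENNReal.ofReal (‖X n p.1‖ ^ 2) * ENNReal.ofReal ((1 - p.2 n / n) ^ 2)
      ∂(P.prod (Measure.infinitePi gammaSucc))
      = (∫⁻ x, ENNReal.ofReal (‖x‖ ^ 2) ∂P.map (X n)) * ENNReal.ofReal ((n + 2) / (n : ℝ) ^ 2) := by
    rw [← lintegral_sq_div_sub_one_gammaSucc hn, ← lintegral_prod_mul (by fun_prop) (by fun_prop),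
      ← map_prodMk_eval_infinitePi_gammaSucc hXmeas, lintegral_map (by fun_prop) (by fun_prop)]
  simp_rw [hpt]
  rw [lintegral_const_mul _ (by fun_prop), hpair]
  refine (mul_le_mul_right (mul_le_mul_left (lintegral_norm_sq_le hn _ (hX n)) _) _).trans
    (le_of_eq ?_)
  rw [show (8 : ℝ≥0∞) = ENNReal.ofReal 8 by simp, ← ENNReal.ofReal_mul (by norm_num),
    ← ENNReal.ofReal_mul (by positivity)]
  congr 1
  field_simp

lemma tendstoInDistribution_fluctuation (hXmeas : ∀ n, Measurable (X n))
    (hX : ∀ n, P.map (X n) = unifOn (scaledLorentzBall2 n)) :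
    TendstoInDistribution
      (fun (n : ℕ) (p : Ω × (ℕ → ℝ)) => √(n : ℝ) / √(Real.log n) * (‖X n p.1‖ - mu2n n)) atTop id
      (fun _ => P.prod (Measure.infinitePi gammaSucc))
      (ProbabilityTheory.gaussianReal 0 (1 / 4)) := by
  have hmeas (n : ℕ) : Measurable fun p : Ω × (ℕ → ℝ) =>
      √(n : ℝ) / √(Real.log n) * (‖X n p.1‖ - mu2n n) := by
    have := hXmeas n
    fun_prop
  refine tendstoInDistribution_of_tendstoInMeasure_sub _ _
    (tendstoInDistribution_gammaFluctuation hXmeas hX) ?_ fun n => (hmeas n).aemeasurable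
  refine tendstoInMeasure_zero_of_lintegral_sq
    (fun n => ((hmeas n).sub (measurable_gammaFluctuation hXmeas n)).aemeasurable) ?_
  refine tendsto_of_tendsto_of_tendsto_of_le_of_le' tendsto_const_nhds tendsto_add_two_div_mul_log
    (Eventually.of_forall fun _ => zero_le) ?_
  filter_upwards [eventually_gt_atTop 0] with n hn
  exact lintegral_sq_sub_gammaFluctuation_le hXmeas hX hn

end Coupling

/-- Theorem C (ii): for `q = 2` and `X̃^{(n)}` uniform on `D̃_{2,1}^n`,
`(√n/√(log n))(‖X̃^{(n)}‖_∞ - μ_{2,n})` converges in distribution to `N(0, 1/4)`.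
Here `‖·‖` on `Fin n → ℝ` is the sup norm. -/
theorem fluctuations_sup_norm_q_two
    {Ω : Type*} [MeasurableSpace Ω] (P : Measure Ω) [IsProbabilityMeasure P]
    (X : (n : ℕ) → Ω → Fin n → ℝ) (hXmeas : ∀ n, Measurable (X n))
    (hX : ∀ n, Measure.map (X n) P = unifOn (scaledLorentzBall2 n)) :
    ∀ f : ℝ → ℝ, Continuous f → (∃ C, ∀ x, |f x| ≤ C) →
      Tendsto (fun n : ℕ =>
          ∫ ω, f (Real.sqrt n / Real.sqrt (Real.log n) * (‖X n ω‖ - mu2n n)) ∂P)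
        atTop (nhds (∫ x, f x ∂(ProbabilityTheory.gaussianReal 0 (1 / 4)))) := by
  rintro f hf ⟨C, hC⟩
  have h := tendstoInDistribution_fluctuation hXmeas hX
  have ht := ProbabilityMeasure.tendsto_iff_forall_integral_tendsto.1 h.tendsto
    (BoundedContinuousFunction.ofNormedAddCommGroup f hf C hC)
  simp only [ProbabilityMeasure.coe_mk, BoundedContinuousFunction.coe_ofNormedAddCommGroup,
    Measure.map_id] at ht
  refine ht.congr fun n => ?_
  rw [integral_map (h.forall_aemeasurable n) hf.aestronglyMeasurable]
  exact integral_fun_fst (fun ω => f (√(n : ℝ) / √(Real.log n) * (‖X n ω‖ - mu2n n))) |>.trans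
    (by simp)

end
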